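/- Let f : ℍ → ℍ be of class C² on an open set Ω of quaternions with nonzero imaginary part, of the form f(p) = u(p) + ι(p)·v(p) with u, v real-valued, and suppose D_l f = −2v/r on Ω. Then, writing quaternions in the form p = t + r·ι(α,β) and regarding v as a function of (t,r,α,β), the Laplacian of the real-valued function v/r satisfies Δ(v/r) = (1/r³)·(−ι·(∂v/∂ιₗ) − ∂²v/∂ιₗ²). -/

import Mathlib

open Quaternion

noncomputable section

/-- The basis quaternion `i`. -/
def qi : ℍ[ℝ] := ⟨0,1,0,0⟩
/-- The basis quaternion `j`. -/
def qj : ℍ[ℝ] := ⟨0,0,1,0⟩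
/-- The basis quaternion `k`. -/
def qk : ℍ[ℝ] := ⟨0,0,0,1⟩

/-- Partial derivative of `f : ℍ → ℍ` in the real (`t`) direction. -/
def pt (f : ℍ[ℝ] → ℍ[ℝ]) (p : ℍ[ℝ]) : ℍ[ℝ] := fderiv ℝ f p 1
/-- Partial derivative in the `i` (`x`) direction. -/
def px (f : ℍ[ℝ] → ℍ[ℝ]) (p : ℍ[ℝ]) : ℍ[ℝ] := fderiv ℝ f p qi
/-- Partial derivative in the `j` (`y`) direction. -/
def py (f : ℍ[ℝ] → ℍ[ℝ]) (p : ℍ[ℝ]) : ℍ[ℝ] := fderiv ℝ f p qj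
/-- Partial derivative in the `k` (`z`) direction. -/
def pz (f : ℍ[ℝ] → ℍ[ℝ]) (p : ℍ[ℝ]) : ℍ[ℝ] := fderiv ℝ f p qk

/-- The left Fueter operator `D_l f = ∂f/∂t + i ∂f/∂x + j ∂f/∂y + k ∂f/∂z`. -/
def Dl (f : ℍ[ℝ] → ℍ[ℝ]) (p : ℍ[ℝ]) : ℍ[ℝ] :=
  pt f p + qi * px f p + qj * py f p + qk * pz f p
/-- The right Fueter operator `D_r f = ∂f/∂t + (∂f/∂x) i + (∂f/∂y) j + (∂f/∂z) k`. -/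
def Dr (f : ℍ[ℝ] → ℍ[ℝ]) (p : ℍ[ℝ]) : ℍ[ℝ] :=
  pt f p + px f p * qi + py f p * qj + pz f p * qk
/-- The conjugate left Fueter operator `D̄_l f = ∂f/∂t - i ∂f/∂x - j ∂f/∂y - k ∂f/∂z`. -/
def Dlbar (f : ℍ[ℝ] → ℍ[ℝ]) (p : ℍ[ℝ]) : ℍ[ℝ] :=
  pt f p - qi * px f p - qj * py f p - qk * pz f p
/-- The Laplacian `Δf = ∂²f/∂t² + ∂²f/∂x² + ∂²f/∂y² + ∂²f/∂z²`. -/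
def Lap (f : ℍ[ℝ] → ℍ[ℝ]) (p : ℍ[ℝ]) : ℍ[ℝ] :=
  pt (pt f) p + px (px f) p + py (py f) p + pz (pz f) p

/-- `r = √(x² + y² + z²)`, the norm of the imaginary part of `p`. -/
def rad (p : ℍ[ℝ]) : ℝ := Real.sqrt (p.imI^2 + p.imJ^2 + p.imK^2)
/-- `ι(p) = (x i + y j + z k)/r`, the normalized imaginary part of `p`. -/
def iot (p : ℍ[ℝ]) : ℍ[ℝ] := (rad p)⁻¹ • Quaternion.im p

/-- `ι(α,β) = cos α sin β · i + sin α sin β · j + cos β · k`, a unit imaginary quaternion. -/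
def iota (α β : ℝ) : ℍ[ℝ] :=
  ⟨0, Real.cos α * Real.sin β, Real.sin α * Real.sin β, Real.cos β⟩
/-- `ι_α = ∂ι/∂α`. -/
def iotaA (α β : ℝ) : ℍ[ℝ] := deriv (fun a => iota a β) α
/-- `ι_β = ∂ι/∂β`. -/
def iotaB (α β : ℝ) : ℍ[ℝ] := deriv (fun b => iota α b) β

/-- Partial derivative in `α` of a quaternion-valued function of `(α,β)`. -/
def pA (g : ℝ → ℝ → ℍ[ℝ]) (α β : ℝ) : ℍ[ℝ] := deriv (fun a => g a β) α
/-- Partial derivative in `β` of a quaternion-valued function of `(α,β)`. -/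
def pB (g : ℝ → ℝ → ℍ[ℝ]) (α β : ℝ) : ℍ[ℝ] := deriv (fun b => g α b) β
/-- The left angular derivative `∂g/∂ιₗ := ι_α⁻¹ (∂g/∂α) + ι_β⁻¹ (∂g/∂β)`. -/
def DI (g : ℝ → ℝ → ℍ[ℝ]) (α β : ℝ) : ℍ[ℝ] :=
  (iotaA α β)⁻¹ * pA g α β + (iotaB α β)⁻¹ * pB g α β

def cR : ℍ[ℝ] →L[ℝ] ℝ := LinearMap.toContinuousLinearMap
  { toFun := fun q => q.re, map_add' := by intros; simp, map_smul' := by intros; simp }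
def cI : ℍ[ℝ] →L[ℝ] ℝ := LinearMap.toContinuousLinearMap
  { toFun := fun q => q.imI, map_add' := by intros; simp, map_smul' := by intros; simp }
def cJ : ℍ[ℝ] →L[ℝ] ℝ := LinearMap.toContinuousLinearMap
  { toFun := fun q => q.imJ, map_add' := by intros; simp, map_smul' := by intros; simp }
def cK : ℍ[ℝ] →L[ℝ] ℝ := LinearMap.toContinuousLinearMap
  { toFun := fun q => q.imK, map_add' := by intros; simp, map_smul' := by intros; simp }
def cO : ℝ →L[ℝ] ℍ[ℝ] := LinearMap.toContinuousLinearMap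
  { toFun := fun q => (q : ℍ[ℝ]), map_add' := by intros; simp, map_smul' := by intros; ext <;> simp }
def cM : ℍ[ℝ] →L[ℝ] ℍ[ℝ] := LinearMap.toContinuousLinearMap
  { toFun := fun q => q.im, map_add' := by intros; ext <;> simp, map_smul' := by intros; ext <;> simp }
theorem cR_apply (q : ℍ[ℝ]) : cR q = q.re := rfl
theorem cI_apply (q : ℍ[ℝ]) : cI q = q.imI := rfl
theorem cJ_apply (q : ℍ[ℝ]) : cJ q = q.imJ := rfl
theorem cK_apply (q : ℍ[ℝ]) : cK q = q.imK := rfl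
theorem cO_apply (q : ℝ) : cO q = (q : ℍ[ℝ]) := rfl
theorem cM_apply (q : ℍ[ℝ]) : cM q = q.im := rfl

@[simp] theorem qi_re : qi.re = 0 := rfl
@[simp] theorem qi_imI : qi.imI = 1 := rfl
@[simp] theorem qi_imJ : qi.imJ = 0 := rfl
@[simp] theorem qi_imK : qi.imK = 0 := rfl
@[simp] theorem qj_re : qj.re = 0 := rfl
@[simp] theorem qj_imI : qj.imI = 0 := rfl
@[simp] theorem qj_imJ : qj.imJ = 1 := rfl
@[simp] theorem qj_imK : qj.imK = 0 := rfl
@[simp] theorem qk_re : qk.re = 0 := rfl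
@[simp] theorem qk_imI : qk.imI = 0 := rfl
@[simp] theorem qk_imJ : qk.imJ = 0 := rfl
@[simp] theorem qk_imK : qk.imK = 1 := rfl
/-- imaginary quaternion from coordinates -/
def m3 (a b c : ℝ) : ℍ[ℝ] := ⟨0, a, b, c⟩
@[simp] theorem m3_re (a b c : ℝ) : (m3 a b c).re = 0 := rfl
@[simp] theorem m3_imI (a b c : ℝ) : (m3 a b c).imI = a := rfl
@[simp] theorem m3_imJ (a b c : ℝ) : (m3 a b c).imJ = b := rfl
@[simp] theorem m3_imK (a b c : ℝ) : (m3 a b c).imK = c := rfl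
theorem m3_eq (a b c : ℝ) : m3 a b c = a • qi + b • qj + c • qk := by
  ext <;> simp

theorem hasDerivAt_quat {f g h : ℝ → ℝ} {f' g' h' x : ℝ} (hf : HasDerivAt f f' x)
    (hg : HasDerivAt g g' x) (hh : HasDerivAt h h' x) :
    HasDerivAt (fun a => m3 (f a) (g a) (h a)) (m3 f' g' h') x := by
  simp only [m3_eq]
  exact ((hf.smul_const qi).add (hg.smul_const qj)).add (hh.smul_const qk)

/-- the second derivative -/
def Hs (w : ℍ[ℝ] → ℝ) (p e e' : ℍ[ℝ]) : ℝ := fderiv ℝ (fderiv ℝ w) p e e'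

theorem hasFDerivAt_partial {w : ℍ[ℝ] → ℝ} {p : ℍ[ℝ]} (hw : ContDiffAt ℝ 2 w p) (e : ℍ[ℝ]) :
    HasFDerivAt (fun q => fderiv ℝ w q e) ((fderiv ℝ (fderiv ℝ w) p).flip e) p := by
  have h1 : DifferentiableAt ℝ (fderiv ℝ w) p :=
    (hw.fderiv_right (m := 1) (by norm_num)).differentiableAt (by norm_num)
  have := h1.hasFDerivAt.clm_apply (hasFDerivAt_const e p)
  refine this.congr_fderiv ?_
  rw [ContinuousLinearMap.comp_zero, zero_add]

theorem ev_diff {w : ℍ[ℝ] → ℝ} {p : ℍ[ℝ]} (hw : ContDiffAt ℝ 2 w p) :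
    ∀ᶠ q in nhds p, DifferentiableAt ℝ w q := by
  filter_upwards [hw.eventually (by norm_num)] with q hq
  exact hq.differentiableAt (by norm_num)

theorem second_coe {w : ℍ[ℝ] → ℝ} {p : ℍ[ℝ]} (hw : ContDiffAt ℝ 2 w p) (e : ℍ[ℝ]) :
    fderiv ℝ (fun q => fderiv ℝ (fun q => ((w q : ℝ) : ℍ[ℝ])) q e) p e = ((Hs w p e e : ℝ) : ℍ[ℝ]) := by
  have h1 : (fun q => fderiv ℝ (fun q => ((w q : ℝ) : ℍ[ℝ])) q e) =ᶠ[nhds p]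
      fun q => cO (fderiv ℝ w q e) := by
    filter_upwards [ev_diff hw] with q hq
    have := (cO.hasFDerivAt.comp q hq.hasFDerivAt).fderiv
    have h2 : (cO ∘ w) = (fun q => ((w q : ℝ) : ℍ[ℝ])) := rfl
    rw [h2] at this
    rw [this]; rfl
  rw [h1.fderiv_eq]
  have := (cO.hasFDerivAt.comp p (hasFDerivAt_partial hw e)).fderiv
  have h2 : (cO ∘ fun q => fderiv ℝ w q e) = (fun q => cO (fderiv ℝ w q e)) := rfl
  rw [h2] at this
  rw [this]; rfl

theorem lap_coe {w : ℍ[ℝ] → ℝ} {p : ℍ[ℝ]} (hw : ContDiffAt ℝ 2 w p) :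
    Lap (fun q => ((w q : ℝ) : ℍ[ℝ])) p =
      ((Hs w p 1 1 + Hs w p qi qi + Hs w p qj qj + Hs w p qk qk : ℝ) : ℍ[ℝ]) := by
  unfold Lap
  have h := fun e => second_coe hw e
  have e1 := h 1
  have e2 := h qi
  have e3 := h qj
  have e4 := h qk
  simp only [pt, px, py, pz] at *
  simp only [Quaternion.coe_add]
  rw [← e1, ← e2, ← e3, ← e4]
  rfl

theorem fueter_first {f : ℍ[ℝ] → ℍ[ℝ]} {u w : ℍ[ℝ] → ℝ} {q : ℍ[ℝ]}
    (hu : DifferentiableAt ℝ u q) (hw : DifferentiableAt ℝ w q)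
    (hf : f =ᶠ[nhds q] fun q => (u q : ℍ[ℝ]) + w q • q.im)
    (hD : Dl f q = ((-2 * w q : ℝ) : ℍ[ℝ])) :
    fderiv ℝ u q 1 = w q + q.imI * fderiv ℝ w q qi + q.imJ * fderiv ℝ w q qj
      + q.imK * fderiv ℝ w q qk ∧
    fderiv ℝ u q qi = - (fderiv ℝ w q 1 * q.imI)
      - (fderiv ℝ w q qj * q.imK - fderiv ℝ w q qk * q.imJ) ∧
    fderiv ℝ u q qj = - (fderiv ℝ w q 1 * q.imJ)
      - (fderiv ℝ w q qk * q.imI - fderiv ℝ w q qi * q.imK) ∧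
    fderiv ℝ u q qk = - (fderiv ℝ w q 1 * q.imK)
      - (fderiv ℝ w q qi * q.imJ - fderiv ℝ w q qj * q.imI) := by
  have h1 : HasFDerivAt f _ q := ((cO.hasFDerivAt.comp q hu.hasFDerivAt).add
    (hw.hasFDerivAt.smul cM.hasFDerivAt)).congr_of_eventuallyEq hf
  have h2 : ∀ e, fderiv ℝ f q e = ((fderiv ℝ u q e : ℝ) : ℍ[ℝ]) +
      (w q • e.im + (fderiv ℝ w q e) • q.im) := by
    intro e; rw [h1.fderiv]; rfl
  simp only [Dl, pt, px, py, pz, h2] at hD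
  simp [Quaternion.ext_iff] at hD
  obtain ⟨h0, h1, h2, h3⟩ := hD
  refine ⟨?_, ?_, ?_, ?_⟩ <;> linarith

theorem fueter_second {f : ℍ[ℝ] → ℍ[ℝ]} {u w : ℍ[ℝ] → ℝ} {p : ℍ[ℝ]}
    (hu : ContDiffAt ℝ 2 u p) (hw : ContDiffAt ℝ 2 w p)
    (hf : f =ᶠ[nhds p] fun q => (u q : ℍ[ℝ]) + w q • q.im)
    (hD : ∀ᶠ q in nhds p, Dl f q = ((-2 * w q : ℝ) : ℍ[ℝ])) :
    (p.imI ^ 2 + p.imJ ^ 2 + p.imK ^ 2) * Hs w p 1 1 =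
      - (2 * (p.imI * fderiv ℝ w p qi + p.imJ * fderiv ℝ w p qj + p.imK * fderiv ℝ w p qk)
      + p.imI * (p.imI * Hs w p qi qi + p.imJ * Hs w p qi qj + p.imK * Hs w p qi qk)
      + p.imJ * (p.imI * Hs w p qj qi + p.imJ * Hs w p qj qj + p.imK * Hs w p qj qk)
      + p.imK * (p.imI * Hs w p qk qi + p.imJ * Hs w p qk qj + p.imK * Hs w p qk qk)) := by
  have ev := ((ev_diff hu).and ((ev_diff hw).and (hf.eventually_nhds.and hD))).mono
    fun q h => fueter_first h.1 h.2.1 h.2.2.1 h.2.2.2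
  have dw := (hw.differentiableAt (by norm_num)).hasFDerivAt
  have e0 := (Filter.EventuallyEq.fderiv_eq (𝕜 := ℝ) (ev.mono fun q h => h.1)).symm.trans (hasFDerivAt_partial hu 1).fderiv
  have e1 := (Filter.EventuallyEq.fderiv_eq (𝕜 := ℝ) (ev.mono fun q h => h.2.1)).symm.trans (hasFDerivAt_partial hu qi).fderiv
  have e2 := (Filter.EventuallyEq.fderiv_eq (𝕜 := ℝ) (ev.mono fun q h => h.2.2.1)).symm.trans (hasFDerivAt_partial hu qj).fderiv
  have e3 := (Filter.EventuallyEq.fderiv_eq (𝕜 := ℝ) (ev.mono fun q h => h.2.2.2)).symm.trans (hasFDerivAt_partial hu qk).fderiv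
  have hp := fun e => hasFDerivAt_partial hw e
  have d0 := (((dw.add ((cI.hasFDerivAt (x := p)).mul (hp qi))).add
    ((cJ.hasFDerivAt (x := p)).mul (hp qj))).add ((cK.hasFDerivAt (x := p)).mul (hp qk))).fderiv
  have d1 := ((((hp 1).mul (cI.hasFDerivAt (x := p))).neg).sub
    (((hp qj).mul (cK.hasFDerivAt (x := p))).sub ((hp qk).mul (cJ.hasFDerivAt (x := p))))).fderiv
  have d2 := ((((hp 1).mul (cJ.hasFDerivAt (x := p))).neg).sub
    (((hp qk).mul (cI.hasFDerivAt (x := p))).sub ((hp qi).mul (cK.hasFDerivAt (x := p))))).fderiv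
  have d3 := ((((hp 1).mul (cK.hasFDerivAt (x := p))).neg).sub
    (((hp qi).mul (cJ.hasFDerivAt (x := p))).sub ((hp qj).mul (cI.hasFDerivAt (x := p))))).fderiv
  replace d0 := d0.symm.trans e0
  replace d1 := d1.symm.trans e1
  replace d2 := d2.symm.trans e2
  replace d3 := d3.symm.trans e3
  have a1 := DFunLike.congr_fun d0 qi
  have a2 := DFunLike.congr_fun d0 qj
  have a3 := DFunLike.congr_fun d0 qk
  have b1 := DFunLike.congr_fun d1 1
  have b2 := DFunLike.congr_fun d2 1
  have b3 := DFunLike.congr_fun d3 1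
  have s := hu.isSymmSndFDerivAt (by simp)
  have s1 := s 1 qi
  have s2 := s 1 qj
  have s3 := s 1 qk
  have q1 : cI qi = 1 ∧ cI qj = 0 ∧ cI qk = 0 ∧ cI 1 = 0 := by simp [cI_apply]
  have q2 : cJ qi = 0 ∧ cJ qj = 1 ∧ cJ qk = 0 ∧ cJ 1 = 0 := by simp [cJ_apply]
  have q3 : cK qi = 0 ∧ cK qj = 0 ∧ cK qk = 1 ∧ cK 1 = 0 := by simp [cK_apply]
  simp [q1, q2, q3] at a1 a2 a3 b1 b2 b3
  simp only [cI_apply, cJ_apply, cK_apply] at a1 a2 a3 b1 b2 b3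
  simp only [Hs]
  linear_combination p.imI * (a1 - b1 - s1) + p.imJ * (a2 - b2 - s2) + p.imK * (a3 - b3 - s3)

/-- the point `t + r ι(a,b)` -/
def pnt (t r a b : ℝ) : ℍ[ℝ] := (t : ℍ[ℝ]) + r • iota a b

theorem iota_eq (a b : ℝ) :
    iota a b = m3 (Real.cos a * Real.sin b) (Real.sin a * Real.sin b) (Real.cos b) := rfl

theorem hasDerivAt_iota_a (a b : ℝ) : HasDerivAt (fun a => iota a b)
    (m3 (-Real.sin a * Real.sin b) (Real.cos a * Real.sin b) 0) a :=
  hasDerivAt_quat ((Real.hasDerivAt_cos a).mul_const _) ((Real.hasDerivAt_sin a).mul_const _)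
    (hasDerivAt_const _ _)

theorem hasDerivAt_iota_b (a b : ℝ) : HasDerivAt (fun b => iota a b)
    (m3 (Real.cos a * Real.cos b) (Real.sin a * Real.cos b) (-Real.sin b)) b :=
  hasDerivAt_quat ((Real.hasDerivAt_sin b).const_mul _) ((Real.hasDerivAt_sin b).const_mul _)
    (Real.hasDerivAt_cos b)

theorem iotaA_inv (a b : ℝ) (hb : Real.sin b ≠ 0) :
    (iotaA a b)⁻¹ = m3 (Real.sin a * (Real.sin b)⁻¹) (-Real.cos a * (Real.sin b)⁻¹) 0 := by
  rw [iotaA, (hasDerivAt_iota_a a b).deriv]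
  apply inv_eq_of_mul_eq_one_right
  have := Real.sin_sq_add_cos_sq a
  ext <;> simp <;> field_simp <;> linarith

theorem iotaB_inv (a b : ℝ) :
    (iotaB a b)⁻¹ = m3 (-Real.cos a * Real.cos b) (-Real.sin a * Real.cos b) (Real.sin b) := by
  rw [iotaB, (hasDerivAt_iota_b a b).deriv]
  apply inv_eq_of_mul_eq_one_right
  have h1 := Real.sin_sq_add_cos_sq a
  have h2 := Real.sin_sq_add_cos_sq b
  ext <;> simp
  · linear_combination (Real.cos b)^2 * h1 + h2
  all_goals ring

theorem DI_eq {g : ℝ → ℝ → ℍ[ℝ]} {a b : ℝ} {A B : ℍ[ℝ]} (hb : Real.sin b ≠ 0)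
    (hA : HasDerivAt (fun a => g a b) A a) (hB : HasDerivAt (fun b => g a b) B b) :
    DI g a b = m3 (Real.sin a * (Real.sin b)⁻¹) (-Real.cos a * (Real.sin b)⁻¹) 0 * A +
      m3 (-Real.cos a * Real.cos b) (-Real.sin a * Real.cos b) (Real.sin b) * B := by
  rw [DI, iotaA_inv _ _ hb, iotaB_inv, pA, pB, hA.deriv, hB.deriv]

theorem map_m3 (L : ℍ[ℝ] →L[ℝ] ℝ) (a b c : ℝ) :
    L (m3 a b c) = a * L qi + b * L qj + c * L qk := by
  rw [m3_eq]; simp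

theorem comp_a {w : ℍ[ℝ] → ℝ} {L : ℍ[ℝ] →L[ℝ] ℝ} {t r a b : ℝ}
    (h : HasFDerivAt w L (pnt t r a b)) :
    HasDerivAt (fun a => w (pnt t r a b))
      (r * (-Real.sin a * Real.sin b * L qi + Real.cos a * Real.sin b * L qj)) a := by
  have h1 : HasDerivAt (fun a => pnt t r a b) _ a :=
    ((hasDerivAt_iota_a a b).const_smul r).const_add (t : ℍ[ℝ])
  have h2 := HasFDerivAt.comp_hasDerivAt a h h1
  refine h2.congr_deriv ?_
  rw [map_smul, map_m3, smul_eq_mul]; ring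

theorem comp_b {w : ℍ[ℝ] → ℝ} {L : ℍ[ℝ] →L[ℝ] ℝ} {t r a b : ℝ}
    (h : HasFDerivAt w L (pnt t r a b)) :
    HasDerivAt (fun b => w (pnt t r a b))
      (r * (Real.cos a * Real.cos b * L qi + Real.sin a * Real.cos b * L qj - Real.sin b * L qk)) b := by
  have h1 : HasDerivAt (fun b => pnt t r a b) _ b :=
    ((hasDerivAt_iota_b a b).const_smul r).const_add (t : ℍ[ℝ])
  have h2 := HasFDerivAt.comp_hasDerivAt b h h1
  refine h2.congr_deriv ?_
  rw [map_smul, map_m3, smul_eq_mul]; ring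

/-- explicit first angular derivative -/
def G1 (r : ℝ) (X Y Z : ℝ → ℝ → ℝ) (a b : ℝ) : ℍ[ℝ] :=
  m3 (r ^ 2 * (Real.sin a * (-Real.sin a * X a b + Real.cos a * Y a b) - Real.cos a * (Real.cos b *
        (Real.cos a * (Real.cos b * X a b) + Real.sin a * (Real.cos b * Y a b) - Real.sin b * Z a b))))
    (r ^ 2 * (-Real.cos a * (-Real.sin a * X a b + Real.cos a * Y a b) - Real.sin a * (Real.cos b *
        (Real.cos a * (Real.cos b * X a b) + Real.sin a * (Real.cos b * Y a b) - Real.sin b * Z a b))))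
    (r ^ 2 * (Real.sin b *
        (Real.cos a * (Real.cos b * X a b) + Real.sin a * (Real.cos b * Y a b) - Real.sin b * Z a b)))

theorem DI_first {w : ℍ[ℝ] → ℝ} {V : ℝ → ℝ → ℍ[ℝ]} {t r a b : ℝ}
    (hV : ∀ a b, V a b = ((r * w (pnt t r a b) : ℝ) : ℍ[ℝ])) (hb : Real.sin b ≠ 0)
    (hw : DifferentiableAt ℝ w (pnt t r a b)) :
    DI V a b = G1 r (fun a b => fderiv ℝ w (pnt t r a b) qi) (fun a b => fderiv ℝ w (pnt t r a b) qj)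
      (fun a b => fderiv ℝ w (pnt t r a b) qk) a b := by
  have hV' : V = fun a b => cO (r * w (pnt t r a b)) := by funext a b; exact hV a b
  subst hV'
  have hA := cO.hasFDerivAt.comp_hasDerivAt a ((comp_a hw.hasFDerivAt).const_mul r)
  have hB := cO.hasFDerivAt.comp_hasDerivAt b ((comp_b hw.hasFDerivAt).const_mul r)
  rw [DI_eq hb hA hB]
  simp only [cO_apply, G1]
  ext <;> simp <;> field_simp <;> ring

/-- derivative in `a` of `G1` -/
theorem G1_a {r a b X' Y' Z' : ℝ} {X Y Z : ℝ → ℝ → ℝ}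
    (hX : HasDerivAt (fun a => X a b) X' a) (hY : HasDerivAt (fun a => Y a b) Y' a)
    (hZ : HasDerivAt (fun a => Z a b) Z' a) :
    HasDerivAt (fun a => G1 r X Y Z a b) 
     (let A := -Real.sin a * X a b + Real.cos a * Y a b
      let A' := -Real.cos a * X a b - Real.sin a * X' - Real.sin a * Y a b + Real.cos a * Y'
      let B := Real.cos a * (Real.cos b * X a b) + Real.sin a * (Real.cos b * Y a b) - Real.sin b * Z a b
      let B' := -Real.sin a * (Real.cos b * X a b) + Real.cos a * (Real.cos b * X') +
        Real.cos a * (Real.cos b * Y a b) + Real.sin a * (Real.cos b * Y') - Real.sin b * Z'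
      m3 (r ^ 2 * (Real.cos a * A + Real.sin a * A' + Real.sin a * (Real.cos b * B) - Real.cos a * (Real.cos b * B')))
        (r ^ 2 * (Real.sin a * A - Real.cos a * A' - Real.cos a * (Real.cos b * B) - Real.sin a * (Real.cos b * B')))
        (r ^ 2 * (Real.sin b * B'))) a := by
  have s := Real.hasDerivAt_sin a
  have c := Real.hasDerivAt_cos a
  have hA := (s.neg.mul hX).add (c.mul hY)
  have hB := ((c.mul (hX.const_mul (Real.cos b))).add (s.mul (hY.const_mul (Real.cos b)))).sub (hZ.const_mul (Real.sin b))
  have h1 := ((s.mul hA).sub (c.mul (hB.const_mul (Real.cos b)))).const_mul (r^2)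
  have h2 := ((c.neg.mul hA).sub (s.mul (hB.const_mul (Real.cos b)))).const_mul (r^2)
  have h3 := (hB.const_mul (Real.sin b)).const_mul (r^2)
  refine (hasDerivAt_quat h1 h2 h3).congr_deriv ?_
  ext <;> simp [-mul_eq_mul_left_iff, -mul_eq_mul_right_iff] <;> ring

/-- derivative in `b` of `G1` -/
theorem G1_b {r a b X' Y' Z' : ℝ} {X Y Z : ℝ → ℝ → ℝ}
    (hX : HasDerivAt (fun b => X a b) X' b) (hY : HasDerivAt (fun b => Y a b) Y' b)
    (hZ : HasDerivAt (fun b => Z a b) Z' b) :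
    HasDerivAt (fun b => G1 r X Y Z a b) 
     (let A' := - Real.sin a * X' + Real.cos a * Y'
      let B := Real.cos a * (Real.cos b * X a b) + Real.sin a * (Real.cos b * Y a b) - Real.sin b * Z a b
      let B' := Real.cos a * (Real.cos b * X' - Real.sin b * X a b) +
        Real.sin a * (Real.cos b * Y' - Real.sin b * Y a b) - Real.cos b * Z a b - Real.sin b * Z'
      m3 (r ^ 2 * (Real.sin a * A' - Real.cos a * (Real.cos b * B' - Real.sin b * B)))
        (r ^ 2 * (-Real.cos a * A' - Real.sin a * (Real.cos b * B' - Real.sin b * B)))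
        (r ^ 2 * (Real.sin b * B' + Real.cos b * B))) b := by
  have s := Real.hasDerivAt_sin b
  have c := Real.hasDerivAt_cos b
  have hA := (hX.const_mul (-Real.sin a)).add (hY.const_mul (Real.cos a))
  have hB := (((c.mul hX).const_mul (Real.cos a)).add ((c.mul hY).const_mul (Real.sin a))).sub (s.mul hZ)
  have h1 := ((hA.const_mul (Real.sin a)).sub ((c.mul hB).const_mul (Real.cos a))).const_mul (r^2)
  have h2 := ((hA.const_mul (-Real.cos a)).sub ((c.mul hB).const_mul (Real.sin a))).const_mul (r^2)
  have h3 := (s.mul hB).const_mul (r^2)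
  refine (hasDerivAt_quat h1 h2 h3).congr_deriv ?_
  ext <;> simp [-mul_eq_mul_left_iff, -mul_eq_mul_right_iff] <;> ring

theorem DI_second {w : ℍ[ℝ] → ℝ} {V : ℝ → ℝ → ℍ[ℝ]} {t r α β : ℝ}
    (hV : ∀ a b, V a b = ((r * w (pnt t r a b) : ℝ) : ℍ[ℝ])) (hb : Real.sin β ≠ 0)
    (hw : ContDiffAt ℝ 2 w (pnt t r α β))
    (hT : (r ^ 2 * ((Real.cos α * Real.sin β) ^ 2 + (Real.sin α * Real.sin β) ^ 2 + (Real.cos β) ^ 2))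
        * Hs w (pnt t r α β) 1 1 =
      - (2 * r * (Real.cos α * Real.sin β * fderiv ℝ w (pnt t r α β) qi +
          Real.sin α * Real.sin β * fderiv ℝ w (pnt t r α β) qj + Real.cos β * fderiv ℝ w (pnt t r α β) qk)
      + r ^ 2 * (Real.cos α * Real.sin β * (Real.cos α * Real.sin β * Hs w (pnt t r α β) qi qi +
          Real.sin α * Real.sin β * Hs w (pnt t r α β) qi qj + Real.cos β * Hs w (pnt t r α β) qi qk)
      + Real.sin α * Real.sin β * (Real.cos α * Real.sin β * Hs w (pnt t r α β) qj qi +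
          Real.sin α * Real.sin β * Hs w (pnt t r α β) qj qj + Real.cos β * Hs w (pnt t r α β) qj qk)
      + Real.cos β * (Real.cos α * Real.sin β * Hs w (pnt t r α β) qk qi +
          Real.sin α * Real.sin β * Hs w (pnt t r α β) qk qj + Real.cos β * Hs w (pnt t r α β) qk qk)))) :
    (r ^ 3) • (((Hs w (pnt t r α β) 1 1 + Hs w (pnt t r α β) qi qi + Hs w (pnt t r α β) qj qj +
        Hs w (pnt t r α β) qk qk : ℝ)) : ℍ[ℝ]) =
      (-(iota α β * DI V α β) - DI (fun a b => DI V a b) α β) := by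
  have hca : Filter.Tendsto (fun a => pnt t r a β) (nhds α) (nhds (pnt t r α β)) :=
    ((((hasDerivAt_iota_a α β).const_smul r).const_add (t : ℍ[ℝ])).continuousAt)
  have hcb : Filter.Tendsto (fun b => pnt t r α b) (nhds β) (nhds (pnt t r α β)) :=
    ((((hasDerivAt_iota_b α β).const_smul r).const_add (t : ℍ[ℝ])).continuousAt)
  have hsb : ∀ᶠ b in nhds β, Real.sin b ≠ 0 :=
    Real.continuous_sin.continuousAt.eventually_ne hb
  have ea : (fun a => DI V a β) =ᶠ[nhds α] fun a => G1 r (fun a b => fderiv ℝ w (pnt t r a b) qi)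
      (fun a b => fderiv ℝ w (pnt t r a b) qj) (fun a b => fderiv ℝ w (pnt t r a b) qk) a β := by
    filter_upwards [hca.eventually (ev_diff hw)] with a h
    exact DI_first hV hb h
  have eb : (fun b => DI V α b) =ᶠ[nhds β] fun b => G1 r (fun a b => fderiv ℝ w (pnt t r a b) qi)
      (fun a b => fderiv ℝ w (pnt t r a b) qj) (fun a b => fderiv ℝ w (pnt t r a b) qk) α b := by
    filter_upwards [hcb.eventually (ev_diff hw), hsb] with b h h'
    exact DI_first hV h' h
  have hp := fun e => hasFDerivAt_partial hw e
  have s := hw.isSymmSndFDerivAt (by simp)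
  have s1 : Hs w (pnt t r α β) qj qi = Hs w (pnt t r α β) qi qj := s qj qi
  have s2 : Hs w (pnt t r α β) qk qi = Hs w (pnt t r α β) qi qk := s qk qi
  have s3 : Hs w (pnt t r α β) qk qj = Hs w (pnt t r α β) qj qk := s qk qj
  have dA := (G1_a (r := r) (comp_a (hp qi)) (comp_a (hp qj)) (comp_a (hp qk))).congr_of_eventuallyEq ea
  have dB := (G1_b (r := r) (comp_b (hp qi)) (comp_b (hp qj)) (comp_b (hp qk))).congr_of_eventuallyEq eb
  rw [DI_eq hb dA dB, ea.eq_of_nhds, iota_eq, G1]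
  have hflip : ∀ e e', ((fderiv ℝ (fderiv ℝ w) (pnt t r α β)).flip e) e' = Hs w (pnt t r α β) e' e :=
    fun e e' => rfl
  simp only [hflip, s1, s2, s3] at hT ⊢
  have c1 := Real.sin_sq_add_cos_sq α
  have c2 := Real.sin_sq_add_cos_sq β
  have c3 : Real.sin β * (Real.sin β)⁻¹ = 1 := mul_inv_cancel₀ hb
  clear hp s dA dB ea eb hca hcb hsb hflip hw hV s1 s2 s3
  generalize (Real.sin β)⁻¹ = ib at *
  generalize Real.sin β = sb at *
  generalize Real.sin α = sa at *
  generalize Real.cos β = cb at *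
  generalize Real.cos α = ca at *
  generalize Hs w (pnt t r α β) 1 1 = H00 at *
  generalize Hs w (pnt t r α β) qi qi = H11 at *
  generalize Hs w (pnt t r α β) qi qj = H12 at *
  generalize Hs w (pnt t r α β) qi qk = H13 at *
  generalize Hs w (pnt t r α β) qj qj = H22 at *
  generalize Hs w (pnt t r α β) qj qk = H23 at *
  generalize Hs w (pnt t r α β) qk qk = H33 at *
  generalize fderiv ℝ w (pnt t r α β) qi = X at *
  generalize fderiv ℝ w (pnt t r α β) qj = Y at *
  generalize fderiv ℝ w (pnt t r α β) qk = Z at *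
  ext <;> simp
  · grind
  · grind
  · grind
  · grind

theorem rad_pnt {t r a b : ℝ} (hr : 0 < r) : rad (pnt t r a b) = r := by
  have h1 := Real.sin_sq_add_cos_sq a
  have h2 := Real.sin_sq_add_cos_sq b
  have : (pnt t r a b).imI^2 + (pnt t r a b).imJ^2 + (pnt t r a b).imK^2 = r ^ 2 := by
    simp [pnt, iota_eq]
    linear_combination r^2 * (Real.sin b)^2 * h1 + r^2 * h2
  rw [rad, this, Real.sqrt_sq hr.le]

theorem rad_sq (q : ℍ[ℝ]) : rad q ^ 2 = q.imI^2 + q.imJ^2 + q.imK^2 :=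
  Real.sq_sqrt (by positivity)

theorem rad_ne (q : ℍ[ℝ]) (h : q.im ≠ 0) : rad q ≠ 0 := by
  intro h0
  have h1 := rad_sq q
  rw [h0] at h1
  apply h
  have a : q.imI = 0 := by nlinarith [sq_nonneg q.imI, sq_nonneg q.imJ, sq_nonneg q.imK]
  have b : q.imJ = 0 := by nlinarith [sq_nonneg q.imI, sq_nonneg q.imJ, sq_nonneg q.imK]
  have c : q.imK = 0 := by nlinarith [sq_nonneg q.imI, sq_nonneg q.imJ, sq_nonneg q.imK]
  ext <;> simp [a, b, c]

/-- If `f` is `C²` on an open set `Ω` of quaternions with nonzero imaginary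
part, of the form `f = u + ι v` with `u, v` real-valued, and `D_l f = -2v/r` on `Ω`, then at
`p = t + r ι(α,β) ∈ Ω` the Laplacian of `v/r` satisfies
`Δ(v/r) = (1/r³)(-ι (∂v/∂ιₗ) - ∂²v/∂ιₗ²)`. -/
theorem laplacian_of_v_over_r (Ω : Set ℍ[ℝ]) (hΩ : IsOpen Ω)
    (hΩim : ∀ p ∈ Ω, Quaternion.im p ≠ 0)
    (f : ℍ[ℝ] → ℍ[ℝ]) (hf : ContDiffOn ℝ 2 f Ω)
    (u v : ℍ[ℝ] → ℝ)
    (hform : ∀ p ∈ Ω, f p = (u p : ℍ[ℝ]) + iot p * (v p : ℍ[ℝ]))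
    (hDl : ∀ p ∈ Ω, Dl f p = ((-2 * v p / rad p : ℝ) : ℍ[ℝ]))
    (t r α β : ℝ) (hr : 0 < r) (hβ : Real.sin β ≠ 0)
    (p : ℍ[ℝ]) (hpdef : p = (t : ℍ[ℝ]) + r • iota α β) (hp : p ∈ Ω)
    (V : ℝ → ℝ → ℍ[ℝ])
    (hV : ∀ a b, V a b = ((v ((t : ℍ[ℝ]) + r • iota a b) : ℝ) : ℍ[ℝ])) :
    Lap (fun q => ((v q / rad q : ℝ) : ℍ[ℝ])) p
      = ((r^3)⁻¹ : ℝ) • (-(iota α β * DI V α β) - DI (fun a b => DI V a b) α β) := by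
  have hform' : ∀ q ∈ Ω, f q = (u q : ℍ[ℝ]) + (v q / rad q) • q.im := by
    intro q hq
    rw [hform q hq, iot]
    ext <;> simp <;> ring
  have hmem : ∀ᶠ q in nhds p, q ∈ Ω := hΩ.mem_nhds hp
  have hfp : ContDiffAt ℝ 2 f p := hf.contDiffAt hmem
  have hu : ContDiffAt ℝ 2 u p := by
    refine (cR.contDiff.contDiffAt.comp p hfp).congr_of_eventuallyEq ?_
    filter_upwards [hmem] with q hq
    simp [cR_apply, hform' q hq]
  have hw : ContDiffAt ℝ 2 (fun q => v q / rad q) p := by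
    have hI := cI.contDiff.contDiffAt (n := 2) (x := p)
    have hJ := cJ.contDiff.contDiffAt (n := 2) (x := p)
    have hK := cK.contDiff.contDiffAt (n := 2) (x := p)
    have fI := cI.contDiff.contDiffAt.comp p hfp
    have fJ := cJ.contDiff.contDiffAt.comp p hfp
    have fK := cK.contDiff.contDiffAt.comp p hfp
    have hne : cI p ^ 2 + cJ p ^ 2 + cK p ^ 2 ≠ 0 := by
      have := rad_sq p
      simp only [cI_apply, cJ_apply, cK_apply]
      rw [← this]
      exact pow_ne_zero 2 (rad_ne p (hΩim p hp))
    refine ((((hI.mul fI).add (hJ.mul fJ)).add (hK.mul fK)).div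
      (((hI.pow 2).add (hJ.pow 2)).add (hK.pow 2)) hne).congr_of_eventuallyEq ?_
    filter_upwards [hmem] with q hq
    have h0 := rad_ne q (hΩim q hq)
    have h1 := rad_sq q
    simp [cI_apply, cJ_apply, cK_apply, hform' q hq]
    rw [← h1]
    field_simp
    rw [h1]
  have hfev : f =ᶠ[nhds p] fun q => (u q : ℍ[ℝ]) + (v q / rad q) • q.im := by
    filter_upwards [hmem] with q hq
    exact hform' q hq
  have hDev : ∀ᶠ q in nhds p, Dl f q = ((-2 * (v q / rad q) : ℝ) : ℍ[ℝ]) := by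
    filter_upwards [hmem] with q hq
    rw [hDl q hq, mul_div_assoc]
  have h2 := fueter_second hu hw hfev hDev
  rw [lap_coe hw]
  have hpp : p = pnt t r α β := hpdef
  have hV' : ∀ a b, V a b = ((r * (fun q => v q / rad q) (pnt t r a b) : ℝ) : ℍ[ℝ]) := by
    intro a b
    rw [hV a b]
    simp only [rad_pnt hr]
    rw [mul_div_cancel₀ _ hr.ne']
    rfl
  clear hpdef
  subst hpp
  rw [← DI_second hV' hβ hw, smul_smul, inv_mul_cancel₀ (pow_ne_zero 3 hr.ne'), one_smul]
  simp [pnt, iota_eq] at h2 ⊢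
  linear_combination h2
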